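/- Let a_n denote the number of permutations of length n in 𝒜, and let F = Σ_{n ≥ 1} a_n xⁿ be the corresponding formal power series in ℚ[[x]]. Then F satisfies the algebraic equation (1 − 4x) · ((1 − x − 2x²) − (1 − x + 2x²)·F)² = ((1 − 3x − 2x²) − (1 − 3x)·F)² in ℚ[[x]]. (The coefficient sequence (a_n) begins 1, 2, 6, 23, 101, 477, 2343, 11762, 59786, 306132.) -/

import Mathlib

/-- `σ` is contained in `π` as a pattern. -/
def Contains {k n : ℕ} (σ : Equiv.Perm (Fin k)) (π : Equiv.Perm (Fin n)) : Prop :=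
  ∃ f : Fin k → Fin n, StrictMono f ∧ ∀ i j : Fin k, σ i < σ j ↔ π (f i) < π (f j)

/-- `π` avoids the pattern `σ`. -/
def Avoids {k n : ℕ} (σ : Equiv.Perm (Fin k)) (π : Equiv.Perm (Fin n)) : Prop :=
  ¬ Contains σ π

/-- The permutation 4231 (0-indexed values). -/
noncomputable def p4231 : Equiv.Perm (Fin 4) := Equiv.ofBijective ![3,1,2,0] (by decide)

/-- The permutation 35142 (0-indexed values). -/
noncomputable def p35142 : Equiv.Perm (Fin 5) := Equiv.ofBijective ![2,4,0,3,1] (by decide)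

/-- The permutation 42513 (0-indexed values). -/
noncomputable def p42513 : Equiv.Perm (Fin 5) := Equiv.ofBijective ![3,1,4,0,2] (by decide)

/-- The permutation 351624 (0-indexed values). -/
noncomputable def p351624 : Equiv.Perm (Fin 6) := Equiv.ofBijective ![2,4,0,5,1,3] (by decide)

/-- Membership in the class 𝒜 = Av(4231, 35142, 42513, 351624). -/
def InA {n : ℕ} (π : Equiv.Perm (Fin n)) : Prop :=
  Avoids p4231 π ∧ Avoids p35142 π ∧ Avoids p42513 π ∧ Avoids p351624 π

/-- `s` is an interval of `π`: a set of consecutive positions whose image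
under `π` is a set of consecutive values. -/
def IsPermInterval {n : ℕ} (π : Equiv.Perm (Fin n)) (s : Finset (Fin n)) : Prop :=
  (∀ a ∈ s, ∀ b ∈ s, ∀ j : Fin n, a ≤ j → j ≤ b → j ∈ s) ∧
  (∀ a ∈ s, ∀ b ∈ s, ∀ j : Fin n, π a ≤ π j → π j ≤ π b → j ∈ s)

/-- `π` is simple: its only intervals are singletons (or empty) and the whole domain. -/
def IsSimple {n : ℕ} (π : Equiv.Perm (Fin n)) : Prop :=
  ∀ s : Finset (Fin n), IsPermInterval π s → s.card ≤ 1 ∨ s = Finset.univ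

/-- The reverse complement of a permutation. -/
def revComp {n : ℕ} (π : Equiv.Perm (Fin n)) : Equiv.Perm (Fin n) :=
  (Fin.revPerm.trans π).trans Fin.revPerm

/-- The skew sum `σ ⊖ τ`. -/
def skewSum {m k : ℕ} (σ : Equiv.Perm (Fin m)) (τ : Equiv.Perm (Fin k)) :
    Equiv.Perm (Fin (m + k)) :=
  finSumFinEquiv.symm.trans ((Equiv.sumCongr σ τ).trans
    ((Equiv.sumComm (Fin m) (Fin k)).trans (finSumFinEquiv.trans (finCongr (Nat.add_comm k m)))))

/-- The direct sum `α ⊕ β`. -/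
def directSum {m k : ℕ} (α : Equiv.Perm (Fin m)) (β : Equiv.Perm (Fin k)) :
    Equiv.Perm (Fin (m + k)) :=
  finSumFinEquiv.symm.trans ((Equiv.sumCongr α β).trans finSumFinEquiv)

/-- The permutation 312 (0-indexed values). -/
noncomputable def p312 : Equiv.Perm (Fin 3) := Equiv.ofBijective ![2,0,1] (by decide)

/-- The permutation 231 (0-indexed values). -/
noncomputable def p231 : Equiv.Perm (Fin 3) := Equiv.ofBijective ![1,2,0] (by decide)

/-- The number of simple permutations of length `n` in the class 𝒜. -/
noncomputable def simpleCount (n : ℕ) : ℕ :=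
  Nat.card {π : Equiv.Perm (Fin n) // IsSimple π ∧ InA π}

/-! ### The generating function of a word -/

section Series

open PowerSeries

/-- The Catalan generating function over `ℚ`. -/
noncomputable def catQ : PowerSeries ℚ := catalanSeries.map (Nat.castRingHom ℚ)

lemma X_mul_catQ_sq : (X : PowerSeries ℚ) * catQ ^ 2 = catQ - 1 := by
  have h := congrArg (PowerSeries.map (Nat.castRingHom ℚ)) catalanSeries_sq_mul_X_add_one
  simp only [map_add, map_mul, map_pow, map_X, map_one] at h
  unfold catQ
  linear_combination h

lemma constantCoeff_catQ : constantCoeff catQ = 1 := by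
  simp [catQ, ← coeff_zero_eq_constantCoeff_apply]

/-- The inverse of `1 + c - c ^ 2`, for `c` the Catalan series. -/
noncomputable def catDen : PowerSeries ℚ := (1 + catQ - catQ ^ 2)⁻¹

lemma catDen_mul : catDen * (1 + catQ - catQ ^ 2) = 1 :=
  PowerSeries.inv_mul_cancel _ (by simp [constantCoeff_catQ])

/-- The constant subtracted from the powers of `catQ` in `runSeries`. -/
noncomputable def catShift : PowerSeries ℚ :=
  (catQ - 1) * catQ ^ 2 + (catQ - 1) * (catQ ^ 2 - 1) * catDen * (catQ ^ 2 - catQ)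

/-- The normalizing factor of the solution of the recurrence for `runSeries` and `siteSeries`. -/
noncomputable def normFactor : PowerSeries ℚ := ((1 - X * catQ) - (1 - X) * catShift)⁻¹

lemma normFactor_mul : normFactor * ((1 - X * catQ) - (1 - X) * catShift) = 1 :=
  PowerSeries.inv_mul_cancel _ (by simp [constantCoeff_catQ, catShift])

/-- The contribution of a site with `T` cuts and `k` trailing non-cuts to its right. -/
noncomputable def siteSeries (T k : ℕ) : PowerSeries ℚ :=
  normFactor * ((catQ - 1) * catQ ^ (2 * T + k) +
    (catQ - 1) * (catQ ^ 2 - 1) * catDen * (catQ ^ (2 * T) - catQ ^ T))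

/-- The generating function of a word consisting of `k` non-cuts. -/
noncomputable def runSeries (k : ℕ) : PowerSeries ℚ := normFactor * (catQ ^ k - catShift)

lemma runSeries_add_siteSeries (k : ℕ) : runSeries k + siteSeries 0 k = runSeries (k + 1) := by
  simp only [runSeries, siteSeries]
  ring

lemma runSeries_zero : runSeries 0 = 1 + X * runSeries 1 := by
  simp only [runSeries]
  linear_combination normFactor_mul

lemma sum_siteSeries (T k : ℕ) :
    ∑ p ∈ Finset.range T, siteSeries (T - p) (p + k + 1) =
      normFactor * (catQ ^ (2 * T + k + 2) - catQ ^ (T + k + 2) +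
        catDen * (catQ - 1) * (catQ ^ (2 * T + 2) - catQ ^ 2) -
        catDen * (catQ ^ 2 - 1) * (catQ ^ (T + 1) - catQ)) := by
  induction T generalizing k with
  | zero => simp
  | succ T ih =>
    rw [Finset.sum_range_succ']
    have h : ∀ p, siteSeries (T + 1 - (p + 1)) (p + 1 + k + 1) =
        siteSeries (T - p) (p + (k + 1) + 1) := by
      intro p
      congr 1 <;> omega
    simp only [h, ih]
    simp only [siteSeries, Nat.sub_zero]
    ring

lemma siteSeries_eq (T k : ℕ) :
    siteSeries T k = X * (siteSeries (T + 1) 0 +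
      ∑ p ∈ Finset.range T, siteSeries (T - p) (p + k + 1) + runSeries (T + k + 2)) := by
  rw [sum_siteSeries]
  simp only [siteSeries, runSeries, catShift]
  have h := X_mul_catQ_sq
  have e := catDen_mul
  linear_combination normFactor * (catQ - 1) ^ 2 * (catQ ^ (2 * T) - 1) * e -
    normFactor * ((catQ - 1) * catQ ^ (2 * T) +
      (catQ - 1) * (catQ ^ 2 - 1) * catDen * catQ ^ (2 * T) + catQ ^ (2 * T + k) +
      catDen * (catQ - 1) * (catQ ^ (2 * T) - 1) - catDen * (catQ ^ 2 - 1) * (catQ ^ T - 1) -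
      (catQ - 1) - (catQ - 1) * (catQ ^ 2 - 1) * catDen) * h

lemma runSeries_zero_eq :
    (1 - 4 * X) * ((1 - X - 2 * X ^ 2) - (1 - X + 2 * X ^ 2) * (runSeries 0 - 1)) ^ 2 =
      ((1 - 3 * X - 2 * X ^ 2) - (1 - 3 * X) * (runSeries 0 - 1)) ^ 2 := by
  have h := X_mul_catQ_sq
  have e := catDen_mul
  have d := normFactor_mul
  have hs : (1 - 4 * X : PowerSeries ℚ) = (1 - 2 * X * catQ) ^ 2 := by
    linear_combination (-4) * X * h
  have key : (1 - 2 * X * catQ) *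
      ((1 - X - 2 * X ^ 2) - (1 - X + 2 * X ^ 2) * (runSeries 0 - 1)) =
      (1 - 3 * X - 2 * X ^ 2) - (1 - 3 * X) * (runSeries 0 - 1) := by
    simp only [runSeries, catShift] at d ⊢
    linear_combination normFactor * catDen * (2 * X + 4 * X * catQ - 4 * X * catQ ^ 2 -
        6 * X ^ 2 * catQ + 4 * X ^ 2 * catQ ^ 2) * h -
      normFactor * (2 * X - 2 * X * catQ + 2 * X * catQ ^ 2 - 4 * X * catQ ^ 3 +
        2 * X * catQ ^ 4 - 2 * X ^ 2 * catQ + 10 * X ^ 2 * catQ ^ 3 - 6 * X ^ 2 * catQ ^ 4 +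
        2 * X ^ 3 * catQ - 6 * X ^ 3 * catQ ^ 2 + 2 * X ^ 3 * catQ ^ 3) * e -
      ((1 - 2 * X * catQ) * (2 - 2 * X) - (2 - 6 * X - 2 * X ^ 2)) * d
  rw [hs, ← key]
  ring

/-- The number of non-cuts at the end of a word. -/
def trailing : List Bool → ℕ
  | [] => 0
  | b :: v => if b = false ∧ v.count true = 0 then trailing v + 1 else trailing v

/-- The generating function, by number of insertions, of the tree below a word of cuts. -/
noncomputable def wordSeries : List Bool → PowerSeries ℚ
  | [] => runSeries 0
  | _ :: v => wordSeries v + siteSeries (v.count true) (trailing v)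

/-- The number of sites of a word that survive an insertion to the left of it. -/
def survivors (v : List Bool) : ℕ := v.count true + trailing v

/-- The sum of `wordSeries` over the children of the word `u ++ w` by insertion at a site of `w`. -/
noncomputable def childSeries : List Bool → List Bool → PowerSeries ℚ
  | u, [] => wordSeries (u ++ [true])
  | u, true :: v => wordSeries (u ++ true :: List.replicate (survivors v + 1) false) +
      childSeries (u ++ [true]) v
  | u, false :: v => wordSeries (List.replicate (survivors v + 2) false) +
      childSeries (u ++ [false]) v

lemma trailing_replicate (k : ℕ) : trailing (List.replicate k false) = k := by
  induction k with
  | zero => rfl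
  | succ k ih => simp [List.replicate_succ, trailing, ih, List.count_replicate]

lemma wordSeries_replicate (k : ℕ) : wordSeries (List.replicate k false) = runSeries k := by
  induction k with
  | zero => rfl
  | succ k ih =>
    rw [List.replicate_succ, wordSeries, ih, trailing_replicate, ← runSeries_add_siteSeries]
    simp [List.count_replicate]

lemma wordSeries_true_replicate (k : ℕ) :
    wordSeries (true :: List.replicate k false) = runSeries (k + 1) := by
  rw [← wordSeries_replicate, List.replicate_succ]
  rfl

lemma trailing_append_true (u : List Bool) (k : ℕ) :
    trailing (u ++ true :: List.replicate k false) = k := by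
  induction u with
  | nil => simp [trailing, trailing_replicate]
  | cons b u ih => simp [trailing, ih]

lemma childSeries_cons (b : Bool) (u w : List Bool) :
    childSeries (b :: u) w = childSeries u w + siteSeries (u.count true + w.count true + 1) 0 +
      ∑ p ∈ Finset.range (w.count true),
        siteSeries (u.count true + w.count true - p) (p + trailing w + 1) := by
  induction w generalizing u with
  | nil =>
    have := trailing_append_true u 0
    simp only [List.replicate_zero] at this
    simp [childSeries, wordSeries, this]
  | cons a v ih =>
    cases a with
    | true =>
      have ih' := ih (u ++ [true])
      simp only [List.count_append, List.count_singleton_self] at ih'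
      simp only [childSeries, List.cons_append, wordSeries, trailing_append_true, ih',
        List.count_append, List.count_cons_self, List.count_replicate, survivors,
        Finset.sum_range_succ]
      simp only [trailing, show ∀ p, u.count true + 1 + v.count true - p =
        u.count true + (v.count true + 1) - p from fun p => by omega,
        show u.count true + (v.count true + 1) - v.count true = u.count true + 1 by omega,
        show u.count true + 1 + v.count true + 1 = u.count true + (v.count true + 1) + 1 by omega]
      simp
      ring
    | false =>
      have ih' := ih (u ++ [false])
      simp only [childSeries, List.cons_append, ih']
      rcases Nat.eq_zero_or_pos (v.count true) with h0 | h0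
      · simp [h0]
        ring
      · have ht : trailing (false :: v) = trailing v := by simp [trailing]; omega
        simp [ht]
        ring

/-- A word has itself and the trees below its children below it. -/
lemma wordSeries_eq (w : List Bool) : wordSeries w = 1 + X * childSeries [] w := by
  induction w with
  | nil =>
    rw [wordSeries, runSeries_zero]
    simp [childSeries, wordSeries, ← runSeries_add_siteSeries, trailing]
  | cons b w ih =>
    have h : childSeries [] (b :: w) = runSeries (survivors w + 2) + childSeries [b] w := by
      cases b
      · simp [childSeries, wordSeries_replicate]
      · simp only [childSeries, List.nil_append, wordSeries_true_replicate]
    rw [h, childSeries_cons, wordSeries, ih, siteSeries_eq (w.count true) (trailing w)]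
    simp only [survivors, List.count_nil, Nat.zero_add]
    ring

lemma constantCoeff_wordSeries (w : List Bool) : constantCoeff (wordSeries w) = 1 := by
  rw [wordSeries_eq]
  simp

end Series
/-! ### Insertion of a new maximum into a list -/

section Insertion

open List

/-- `l` contains none of the patterns 4231, 35142, 42513, 351624. -/
def GoodList (l : List ℕ) : Prop :=
  (∀ a b c d, [a, b, c, d] <+ l → ¬ (d < b ∧ b < c ∧ c < a)) ∧
  (∀ a b c d e, [a, b, c, d, e] <+ l → ¬ (c < e ∧ e < a ∧ a < d ∧ d < b)) ∧
  (∀ a b c d e, [a, b, c, d, e] <+ l → ¬ (d < b ∧ b < e ∧ e < a ∧ a < c)) ∧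
  (∀ a b c d e f, [a, b, c, d, e, f] <+ l → ¬ (c < e ∧ e < a ∧ a < f ∧ f < b ∧ b < d))

/-- A new maximum between `x` and `y` creates none of the four patterns. -/
def IsActive (x y : List ℕ) : Prop :=
  (∀ b c d, [b, c, d] <+ y → ¬ (d < b ∧ b < c)) ∧
  (∀ a, [a] <+ x → ∀ p q r, [p, q, r] <+ y → ¬ (p < r ∧ r < a ∧ a < q)) ∧
  (∀ a b, [a, b] <+ x → ∀ p q, [p, q] <+ y → ¬ (p < b ∧ b < q ∧ q < a)) ∧
  (∀ a b c, [a, b, c] <+ x → ∀ p q, [p, q] <+ y → ¬ (c < p ∧ p < a ∧ a < q ∧ q < b))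

/-- All entries of `x` are smaller than all entries of `y`. -/
def IsCut (x y : List ℕ) : Prop := ∀ a ∈ x, ∀ b ∈ y, a < b

lemma sublist_insert_iff {s x y : List ℕ} {M : ℕ} :
    s <+ x ++ M :: y ↔ s <+ x ++ y ∨ ∃ s₁ s₂, s = s₁ ++ M :: s₂ ∧ s₁ <+ x ∧ s₂ <+ y := by
  constructor
  · intro h
    obtain ⟨s₁, t, rfl, h₁, ht⟩ := sublist_append_iff.1 h
    rcases sublist_cons_iff.1 ht with h₂ | ⟨s₂, rfl, h₂⟩
    · exact Or.inl (h₁.append h₂)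
    · exact Or.inr ⟨s₁, s₂, rfl, h₁, h₂⟩
  · rintro (h | ⟨s₁, s₂, rfl, h₁, h₂⟩)
    · exact h.trans ((sublist_cons_self M y).append_left x)
    · exact h₁.append (h₂.cons_cons M)

lemma lt_of_sublist {s x : List ℕ} {M : ℕ} (h : s <+ x) (hx : ∀ a ∈ x, a < M) :
    ∀ a ∈ s, a < M := fun a ha => hx a (h.subset ha)

lemma goodList_insert_iff {x y : List ℕ} {M : ℕ} (hx : ∀ a ∈ x, a < M) (hy : ∀ a ∈ y, a < M) :
    GoodList (x ++ M :: y) ↔ GoodList (x ++ y) ∧ IsActive x y := by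
  constructor
  · intro ⟨h1, h2, h3, h4⟩
    have hs : ∀ s, s <+ x ++ y → s <+ x ++ M :: y := fun s h => sublist_insert_iff.2 (Or.inl h)
    refine ⟨⟨fun a b c d h => h1 _ _ _ _ (hs _ h), fun a b c d e h => h2 _ _ _ _ _ (hs _ h),
      fun a b c d e h => h3 _ _ _ _ _ (hs _ h), fun a b c d e f h => h4 _ _ _ _ _ _ (hs _ h)⟩,
      ?_, ?_, ?_, ?_⟩
    · intro b c d h
      have := h1 M b c d (sublist_insert_iff.2 (Or.inr ⟨[], _, rfl, nil_sublist _, h⟩))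
      have := lt_of_sublist h hy
      simp at this
      omega
    · intro a ha p q r h
      have := h2 a M p q r (sublist_insert_iff.2 (Or.inr ⟨[a], _, rfl, ha, h⟩))
      have := lt_of_sublist h hy
      simp at this
      omega
    · intro a b ha p q h
      have := h3 a b M p q (sublist_insert_iff.2 (Or.inr ⟨[a, b], _, rfl, ha, h⟩))
      have := lt_of_sublist ha hx
      simp at this
      omega
    · intro a b c ha p q h
      have := h4 a b c M p q (sublist_insert_iff.2 (Or.inr ⟨[a, b, c], _, rfl, ha, h⟩))
      have := lt_of_sublist ha hx
      simp at this
      omega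
  · rintro ⟨⟨h1, h2, h3, h4⟩, k1, k2, k3, k4⟩
    refine ⟨?_, ?_, ?_, ?_⟩
    · intro a b c d h
      rcases sublist_insert_iff.1 h with h | ⟨s, t, he, hs, ht⟩
      · exact h1 _ _ _ _ h
      · have us := lt_of_sublist hs hx
        have ut := lt_of_sublist ht hy
        rcases s with _ | ⟨_, _ | ⟨_, _ | ⟨_, _ | ⟨_, _⟩⟩⟩⟩ <;> simp at he
        all_goals
          repeat obtain ⟨rfl, he⟩ := he
          try subst he
          simp at us ut
          first
            | omega
            | exact fun hh => k1 _ _ _ ht (by omega)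
    · intro a b c d e h
      rcases sublist_insert_iff.1 h with h | ⟨s, t, he, hs, ht⟩
      · exact h2 _ _ _ _ _ h
      · have us := lt_of_sublist hs hx
        have ut := lt_of_sublist ht hy
        rcases s with _ | ⟨_, _ | ⟨_, _ | ⟨_, _ | ⟨_, _ | ⟨_, _⟩⟩⟩⟩⟩ <;> simp at he
        all_goals
          repeat obtain ⟨rfl, he⟩ := he
          try subst he
          simp at us ut
          first
            | omega
            | exact fun hh => k2 _ hs _ _ _ ht (by omega)
    · intro a b c d e h
      rcases sublist_insert_iff.1 h with h | ⟨s, t, he, hs, ht⟩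
      · exact h3 _ _ _ _ _ h
      · have us := lt_of_sublist hs hx
        have ut := lt_of_sublist ht hy
        rcases s with _ | ⟨_, _ | ⟨_, _ | ⟨_, _ | ⟨_, _ | ⟨_, _⟩⟩⟩⟩⟩ <;> simp at he
        all_goals
          repeat obtain ⟨rfl, he⟩ := he
          try subst he
          simp at us ut
          first
            | omega
            | exact fun hh => k3 _ _ hs _ _ ht (by omega)
    · intro a b c d e f h
      rcases sublist_insert_iff.1 h with h | ⟨s, t, he, hs, ht⟩
      · exact h4 _ _ _ _ _ _ h
      · have us := lt_of_sublist hs hx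
        have ut := lt_of_sublist ht hy
        rcases s with _ | ⟨_, _ | ⟨_, _ | ⟨_, _ | ⟨_, _ | ⟨_, _ | ⟨_, _⟩⟩⟩⟩⟩⟩ <;> simp at he
        all_goals
          repeat obtain ⟨rfl, he⟩ := he
          try subst he
          simp at us ut
          first
            | omega
            | exact fun hh => k4 _ _ _ hs _ _ ht (by omega)

lemma isActive_insert_right_iff {x y z : List ℕ} {M : ℕ} (hx : ∀ a ∈ x, a < M)
    (hy : ∀ a ∈ y, a < M) (hz : ∀ a ∈ z, a < M) (hne : ∀ a ∈ x ++ y, ∀ b ∈ z, a ≠ b) :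
    IsActive x (y ++ M :: z) ↔ IsActive x (y ++ z) ∧ (y = [] ∨ IsCut (x ++ y) z) := by
  constructor
  · intro ⟨h1, h2, h3, h4⟩
    have hs : ∀ s, s <+ y ++ z → s <+ y ++ M :: z := fun s h => sublist_insert_iff.2 (Or.inl h)
    have hM : ∀ b ∈ y, ∀ d ∈ z, [b, M, d] <+ y ++ M :: z := fun b hb d hd =>
      sublist_insert_iff.2 (Or.inr ⟨[b], [d], rfl, singleton_sublist.2 hb, singleton_sublist.2 hd⟩)
    refine ⟨⟨fun b c d h => h1 _ _ _ (hs _ h), fun a ha p q r h => h2 _ ha _ _ _ (hs _ h),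
      fun a b ha p q h => h3 _ _ ha _ _ (hs _ h),
      fun a b c ha p q h => h4 _ _ _ ha _ _ (hs _ h)⟩, ?_⟩
    rcases y with _ | ⟨b, y⟩
    · exact Or.inl rfl
    · refine Or.inr fun a ha d hd => ?_
      by_contra hlt
      have hda : d < a := lt_of_le_of_ne (not_lt.1 hlt) (hne a ha d hd).symm
      rcases mem_append.1 ha with hax | hay
      · have hbd := hne b (by simp) d hd
        have hb := hM b (by simp) d hd
        have := hx a hax
        have := hy b (by simp)
        rcases lt_or_gt_of_ne hbd with h | h
        · exact h2 a (singleton_sublist.2 hax) _ _ _ hb (by omega)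
        · exact h1 _ _ _ hb (by omega)
      · exact h1 _ _ _ (hM a hay d hd) ⟨hda, hy a hay⟩
  · rintro ⟨⟨h1, h2, h3, h4⟩, hc⟩
    have hc' : ∀ b ∈ y, ∀ a ∈ x ++ y, ∀ d ∈ z, a < d := by
      rcases hc with rfl | hc
      · simp
      · exact fun _ _ => hc
    refine ⟨?_, ?_, ?_, ?_⟩
    · intro b c d h
      rcases sublist_insert_iff.1 h with h | ⟨s, t, he, hs, ht⟩
      · exact h1 _ _ _ h
      · have us := lt_of_sublist hs hy
        have ut := lt_of_sublist ht hz
        rcases s with _ | ⟨_, _ | ⟨_, _ | ⟨_, _⟩⟩⟩ <;> simp at he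
        all_goals
          repeat obtain ⟨rfl, he⟩ := he
          try subst he
          simp at us ut
          try omega
        have hb := singleton_sublist.1 hs
        have := hc' b hb b (by simp [hb]) d (singleton_sublist.1 ht)
        omega
    · intro a ha p q r h
      rcases sublist_insert_iff.1 h with h | ⟨s, t, he, hs, ht⟩
      · exact h2 _ ha _ _ _ h
      · have us := lt_of_sublist hs hy
        have ut := lt_of_sublist ht hz
        have ua := lt_of_sublist ha hx
        rcases s with _ | ⟨_, _ | ⟨_, _ | ⟨_, _⟩⟩⟩ <;> simp at he
        all_goals
          repeat obtain ⟨rfl, he⟩ := he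
          try subst he
          simp at us ut ua
          try omega
        have hb := singleton_sublist.1 hs
        have := hc' p hb a (by simp [singleton_sublist.1 ha]) r (singleton_sublist.1 ht)
        omega
    · intro a b ha p q h
      rcases sublist_insert_iff.1 h with h | ⟨s, t, he, hs, ht⟩
      · exact h3 _ _ ha _ _ h
      · have us := lt_of_sublist hs hy
        have ut := lt_of_sublist ht hz
        have ua := lt_of_sublist ha hx
        rcases s with _ | ⟨_, _ | ⟨_, _⟩⟩ <;> simp at he
        all_goals
          repeat obtain ⟨rfl, he⟩ := he
          try subst he
          simp at us ut ua
          omega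
    · intro a b c ha p q h
      rcases sublist_insert_iff.1 h with h | ⟨s, t, he, hs, ht⟩
      · exact h4 _ _ _ ha _ _ h
      · have us := lt_of_sublist hs hy
        have ut := lt_of_sublist ht hz
        have ua := lt_of_sublist ha hx
        rcases s with _ | ⟨_, _ | ⟨_, _⟩⟩ <;> simp at he
        all_goals
          repeat obtain ⟨rfl, he⟩ := he
          try subst he
          simp at us ut ua
          omega

/-- A maximum inserted between `x` and `y` prevents a further insertion between `y` and `z`. -/
def Blocks (x y z : List ℕ) : Prop :=
  ∃ b ∈ y, ∃ p q, [p, q] <+ z ∧ ((p < b ∧ b < q) ∨ ∃ a ∈ x, b < p ∧ p < a ∧ a < q)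

lemma isActive_insert_left_iff {x y z : List ℕ} {M : ℕ} (hx : ∀ a ∈ x, a < M)
    (hy : ∀ a ∈ y, a < M) (hz : ∀ a ∈ z, a < M) :
    IsActive (x ++ M :: y) z ↔ IsActive (x ++ y) z ∧ ¬ Blocks x y z := by
  constructor
  · intro ⟨h1, h2, h3, h4⟩
    have hs : ∀ s, s <+ x ++ y → s <+ x ++ M :: y := fun s h => sublist_insert_iff.2 (Or.inl h)
    refine ⟨⟨h1, fun a ha p q r h => h2 _ (hs _ ha) _ _ _ h,
      fun a b ha p q h => h3 _ _ (hs _ ha) _ _ h,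
      fun a b c ha p q h => h4 _ _ _ (hs _ ha) _ _ h⟩, ?_⟩
    rintro ⟨b, hb, p, q, hpq, hor⟩
    have hq := lt_of_sublist hpq hz
    simp at hq
    rcases hor with h | ⟨a, ha, h⟩
    · exact h3 M b (sublist_insert_iff.2 (Or.inr ⟨[], [b], rfl, nil_sublist _,
        singleton_sublist.2 hb⟩)) p q hpq (by omega)
    · exact h4 a M b (sublist_insert_iff.2 (Or.inr ⟨[a], [b], rfl, singleton_sublist.2 ha,
        singleton_sublist.2 hb⟩)) p q hpq (by omega)
  · rintro ⟨⟨h1, h2, h3, h4⟩, hB⟩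
    refine ⟨h1, ?_, ?_, ?_⟩
    · intro a ha p q r h
      rcases sublist_insert_iff.1 ha with ha | ⟨s, t, he, hs, ht⟩
      · exact h2 _ ha _ _ _ h
      · have uz := lt_of_sublist h hz
        rcases s with _ | ⟨_, _⟩ <;> simp at he
        obtain ⟨rfl, he⟩ := he
        simp at uz
        omega
    · intro a b ha p q h
      rcases sublist_insert_iff.1 ha with ha | ⟨s, t, he, hs, ht⟩
      · exact h3 _ _ ha _ _ h
      · have us := lt_of_sublist hs hx
        have ut := lt_of_sublist ht hy
        have uz := lt_of_sublist h hz
        rcases s with _ | ⟨_, _ | ⟨_, _⟩⟩ <;> simp at he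
        all_goals
          repeat obtain ⟨rfl, he⟩ := he
          try subst he
          simp at us ut uz
          try omega
        exact fun hh => hB ⟨b, singleton_sublist.1 ht, p, q, h, Or.inl ⟨hh.1, hh.2.1⟩⟩
    · intro a b c ha p q h
      rcases sublist_insert_iff.1 ha with ha | ⟨s, t, he, hs, ht⟩
      · exact h4 _ _ _ ha _ _ h
      · have us := lt_of_sublist hs hx
        have ut := lt_of_sublist ht hy
        have uz := lt_of_sublist h hz
        rcases s with _ | ⟨_, _ | ⟨_, _ | ⟨_, _⟩⟩⟩ <;> simp at he
        all_goals
          repeat obtain ⟨rfl, he⟩ := he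
          try subst he
          simp at us ut uz
          try omega
        exact fun hh => hB ⟨c, singleton_sublist.1 ht, p, q, h,
          Or.inr ⟨a, singleton_sublist.1 hs, hh.1, hh.2.1, hh.2.2.1⟩⟩

lemma pair_sublist_or {l : List ℕ} {a b : ℕ} (ha : a ∈ l) (hb : b ∈ l) (hab : a ≠ b) :
    [a, b] <+ l ∨ [b, a] <+ l := by
  obtain ⟨s, t, rfl⟩ := append_of_mem ha
  rcases mem_append.1 hb with h | h
  · exact Or.inr ((singleton_sublist.2 h).append (singleton_sublist.2 (by simp)))
  · rcases mem_cons.1 h with rfl | h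
    · exact absurd rfl hab
    · exact Or.inl (((singleton_sublist.2 h).cons_cons a).trans (sublist_append_right s _))

lemma exists_first_of_mem {l : List ℕ} {q : ℕ} (P : ℕ → Prop) (hq : q ∈ l) (hP : P q) :
    ∃ s r t, l = s ++ r :: t ∧ P r ∧ ∀ w ∈ s, ¬ P w := by
  induction l with
  | nil => simp at hq
  | cons a l ih =>
    by_cases ha : P a
    · exact ⟨[], a, l, rfl, ha, by simp⟩
    · rcases mem_cons.1 hq with rfl | hq
      · exact absurd hP ha
      · obtain ⟨s, r, t, rfl, hr, hs⟩ := ih hq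
        exact ⟨a :: s, r, t, rfl, hr, by simpa using ⟨ha, hs⟩⟩

/-- When two sites are active, blocking is a matter of cuts. -/
lemma blocks_iff {x y z : List ℕ} (h₁ : IsActive x (y ++ z)) (h₂ : IsActive (x ++ y) z)
    (hnd : (x ++ y ++ z).Nodup) (hy : y ≠ []) :
    Blocks x y z ↔ ¬ IsCut (x ++ y) z ∧
      ∃ z₁ z₂, z = z₁ ++ z₂ ∧ z₁ ≠ [] ∧ z₂ ≠ [] ∧ IsCut (x ++ y ++ z₁) z₂ := by
  have hne : ∀ a ∈ x ++ y, ∀ b ∈ z, a ≠ b := fun a ha b hb hab =>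
    (nodup_append.1 hnd).2.2 a ha b hb hab
  obtain ⟨k1, k2, -, -⟩ := h₁
  obtain ⟨-, -, j3, j4⟩ := h₂
  have pre : ∀ {u s t : List ℕ} {b : ℕ}, b ∈ s → u <+ t → b :: u <+ s ++ t := fun hb hu =>
    (singleton_sublist.2 hb).append hu
  constructor
  · rintro ⟨b, hb, p, q, hpq, hor⟩
    have hpz : p ∈ z := hpq.subset (by simp)
    have hbq : b < q := by rcases hor with h | ⟨a, ha, h⟩ <;> omega
    refine ⟨fun hc => ?_, ?_⟩
    · rcases hor with h | ⟨a, ha, h⟩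
      · have := hc b (by simp [hb]) p hpz
        omega
      · have := hc a (by simp [ha]) p hpz
        omega
    obtain ⟨z₀, r, rfl, hq⟩ : ∃ z₀ r, z = z₀ ++ p :: r ∧ q ∈ r := by
      obtain ⟨s, t, rfl, hs, ht⟩ := cons_sublist_iff.1 hpq
      obtain ⟨s₁, s₂, rfl⟩ := append_of_mem hs
      exact ⟨s₁, s₂ ++ t, by simp, by simp [singleton_sublist.1 ht]⟩
    have hzq : ∀ m ∈ z₀, [m, p, q] <+ z₀ ++ p :: r := fun m hm =>
      pre hm ((singleton_sublist.2 hq).cons_cons p)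
    -- no entry before `p` exceeds `q`
    have hbig : ∀ m ∈ x ++ y ++ z₀, ¬ q < m := by
      intro m hm hqm
      rcases mem_append.1 hm with hm | hmz
      · rcases mem_append.1 hm with hmx | hmy
        · rcases hor with h | ⟨a, ha, h⟩
          · exact j3 m b (pre hmx (singleton_sublist.2 hb)) p q hpq (by omega)
          · rcases pair_sublist_or ha hmx (by omega) with h' | h'
            · exact j4 a m b (h'.append (singleton_sublist.2 hb)) p q hpq (by omega)
            · exact j3 m a (h'.trans (sublist_append_left _ _)) p q hpq (by omega)
        · rcases pair_sublist_or hb hmy (by omega) with h' | h'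
          · have h₃ : [b, m, p] <+ y ++ (z₀ ++ p :: r) := h'.append (singleton_sublist.2 hpz)
            rcases hor with h | ⟨a, ha, h⟩
            · exact k1 _ _ _ h₃ (by omega)
            · exact k2 a (singleton_sublist.2 ha) _ _ _ h₃ (by omega)
          · rcases hor with h | ⟨a, ha, h⟩
            · exact j3 m b (h'.trans (sublist_append_right _ _)) p q hpq (by omega)
            · exact j4 a m b (pre ha h') p q hpq (by omega)
      · have h₃ : [b, m, p] <+ y ++ (z₀ ++ p :: r) :=
          pre hb (pre hmz (singleton_sublist.2 (by simp)))
        rcases hor with h | ⟨a, ha, h⟩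
        · exact k1 _ _ _ h₃ (by omega)
        · exact k2 a (singleton_sublist.2 ha) _ _ _ h₃ (by omega)
    have hall : ∀ m ∈ x ++ y ++ (z₀ ++ [p]), m < q := by
      intro m hm
      have hmq : m ≠ q := by
        have h' : (x ++ y ++ (z₀ ++ [p]) ++ r).Nodup := by simpa using hnd
        exact (nodup_append.1 h').2.2 m hm q hq
      have hpq' : p < q := by rcases hor with h | ⟨a, ha, h⟩ <;> omega
      rw [← append_assoc, mem_append, mem_singleton] at hm
      rcases hm with hm | rfl
      · have := hbig m hm
        omega
      · exact hpq'
    obtain ⟨s, q', t, rfl, hq', hs⟩ :=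
      exists_first_of_mem (fun e => ∀ m ∈ x ++ y ++ (z₀ ++ [p]), m < e) hq hall
    have hlt : ∀ u ∈ x ++ y ++ (z₀ ++ p :: s), u < q' := by
      intro u hu
      have hu' : u ∈ x ++ y ++ (z₀ ++ [p]) ∨ u ∈ s := by
        simp only [mem_append, mem_cons, not_mem_nil, or_false] at hu ⊢
        tauto
      rcases hu' with hu' | hu'
      · exact hq' u hu'
      · have := hs u hu'
        simp only [not_forall, not_lt] at this
        obtain ⟨m, hm, hmu⟩ := this
        exact lt_of_le_of_lt hmu (hq' m hm)
    refine ⟨z₀ ++ p :: s, q' :: t, by simp, by simp, by simp, ?_⟩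
    intro u hu w hw
    rcases mem_cons.1 hw with rfl | hw
    · exact hlt u hu
    have hbq' := hlt b (by simp [hb])
    have huq' := hlt u hu
    have hnd' : (x ++ y ++ (z₀ ++ p :: s) ++ (q' :: t)).Nodup := by simpa using hnd
    have huw : u ≠ w := (nodup_append.1 hnd').2.2 u hu w (by simp [hw])
    have hbw : b ≠ w := (nodup_append.1 hnd').2.2 b (by simp [hb]) w (by simp [hw])
    have hqw : [q', w] <+ q' :: t := (singleton_sublist.2 hw).cons_cons q'
    by_contra hlt'
    have hwu : w < u := by omega
    have htail : ∀ v ∈ y ++ (z₀ ++ p :: s), [v, q', w] <+ y ++ (z₀ ++ p :: (s ++ q' :: t)) := by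
      intro v hv
      simpa using pre hv hqw
    rcases mem_append.1 (by simpa using hu : u ∈ x ++ (y ++ (z₀ ++ p :: s))) with hux | huy
    · have h₃ := htail b (by simp [hb])
      rcases lt_or_gt_of_ne hbw with h | h
      · exact k2 u (singleton_sublist.2 hux) _ _ _ h₃ (by omega)
      · exact k1 _ _ _ h₃ (by omega)
    · exact k1 _ _ _ (htail u huy) (by omega)
  · rintro ⟨hc, z₁, z₂, rfl, hz₁, hz₂, hcut⟩
    obtain ⟨b, hb⟩ := exists_mem_of_ne_nil y hy
    obtain ⟨q, hq⟩ := exists_mem_of_ne_nil z₂ hz₂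
    simp only [IsCut, not_forall, not_lt] at hc
    obtain ⟨a, ha, d, hd, hda⟩ := hc
    have had := hne a ha d hd
    have hbd := hne b (by simp [hb]) d hd
    have hdz : d ∈ z₁ := by
      rcases mem_append.1 hd with h | h
      · exact h
      · have := hcut a (by simp at ha ⊢; tauto) d h
        omega
    have hbq := hcut b (by simp [hb]) q hq
    have haq := hcut a (by simp at ha ⊢; tauto) q hq
    have hs : [d, q] <+ z₁ ++ z₂ := pre hdz (singleton_sublist.2 hq)
    rcases mem_append.1 ha with hax | hay
    · refine ⟨b, hb, d, q, hs, ?_⟩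
      rcases lt_or_gt_of_ne hbd with h | h
      · exact Or.inr ⟨a, hax, h, by omega, haq⟩
      · exact Or.inl ⟨h, hbq⟩
    · exact ⟨a, hay, d, q, hs, Or.inl ⟨by omega, haq⟩⟩

lemma isActive_of_isCut {x y : List ℕ} (hy : ∀ b c d, [b, c, d] <+ y → ¬ (d < b ∧ b < c))
    (h : IsCut x y) : IsActive x y := by
  refine ⟨hy, fun a ha p q r hs => ?_, fun a b ha p q hs => ?_, fun a b c ha p q hs => ?_⟩
  · have := h a (ha.subset (by simp)) r (hs.subset (by simp))
    omega
  · have := h b (ha.subset (by simp)) p (hs.subset (by simp))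
    omega
  · have := h a (ha.subset (by simp)) p (hs.subset (by simp))
    omega

open Classical in
/-- The word of the site between `x` and `y`: empty unless the site is active. -/
noncomputable def siteWord (x y : List ℕ) : List Bool :=
  if IsActive x y then [decide (IsCut x y)] else []

lemma siteWord_congr {x y x' y' : List ℕ} (hA : IsActive x y ↔ IsActive x' y')
    (hC : IsCut x y ↔ IsCut x' y') : siteWord x y = siteWord x' y' := by
  unfold siteWord
  rw [propext hA, propext hC]

/-- The cut flags of the active sites of `x ++ y ++ z` which lie weakly to the right of `x` and
strictly to the left of the end of `y`. -/
noncomputable def cutWord : List ℕ → List ℕ → List ℕ → List Bool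
  | _, [], _ => []
  | x, a :: y, z => siteWord x (a :: y ++ z) ++ cutWord (x ++ [a]) y z

lemma cutWord_append (x y₁ y₂ z : List ℕ) :
    cutWord x (y₁ ++ y₂) z = cutWord x y₁ (y₂ ++ z) ++ cutWord (x ++ y₁) y₂ z := by
  induction y₁ generalizing x with
  | nil => simp [cutWord]
  | cons a y₁ ih => simp [cutWord, ih]

open Classical in
lemma cutWord_insert_right {u v y : List ℕ} {M : ℕ} (hx : ∀ a ∈ u ++ v, a < M)
    (hy : ∀ a ∈ y, a < M) (hne : ∀ a ∈ u ++ v, ∀ b ∈ y, a ≠ b) :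
    cutWord u v (M :: y) = if IsCut (u ++ v) y then cutWord u v y else [] := by
  induction v generalizing u with
  | nil => simp [cutWord]
  | cons a v ih =>
    have h := ih (u := u ++ [a]) (by simpa using hx) (by simpa using hne)
    have e := isActive_insert_right_iff (x := u) (y := a :: v) (z := y)
      (fun b hb => hx b (by simp [hb])) (fun b hb => hx b (mem_append_right _ hb)) hy hne
    have hc : IsCut u (a :: v ++ M :: y) ↔ IsCut u (a :: v ++ y) := by
      refine forall₂_congr fun b hb => ?_
      have := hx b (by simp [hb])
      simp only [mem_append, mem_cons]
      grind
    simp only [append_assoc, singleton_append] at h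
    rw [cutWord, h, cutWord]
    by_cases hcut : IsCut (u ++ a :: v) y
    · rw [if_pos hcut, if_pos hcut, siteWord_congr (e.trans (by simp [hcut])) hc]
    · have hna : ¬ IsActive u (a :: v ++ M :: y) := by
        rw [e]
        simp [hcut]
      simp only [siteWord, if_neg hna, hcut, if_false, append_nil]

lemma siteWord_insert_right {x y : List ℕ} {M : ℕ} (hx : ∀ a ∈ x, a < M)
    (hy : ∀ a ∈ y, a < M) (hne : ∀ a ∈ x, ∀ b ∈ y, a ≠ b) :
    siteWord x (M :: y) = siteWord x y := by
  have e := isActive_insert_right_iff (x := x) (y := []) (z := y) hx (by simp) hy (by simpa)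
  have hc : IsCut x (M :: y) ↔ IsCut x y := by
    refine forall₂_congr fun b hb => ?_
    simp [hx b hb]
  simp only [nil_append, true_or, and_true] at e
  exact siteWord_congr e hc

lemma count_cutWord_pos {x y : List ℕ} (hy : ∀ b c d, [b, c, d] <+ y → ¬ (d < b ∧ b < c)) :
    (cutWord x y []).count true ≠ 0 ↔
      ∃ z₁ z₂, y = z₁ ++ z₂ ∧ z₂ ≠ [] ∧ IsCut (x ++ z₁) z₂ := by
  induction y generalizing x with
  | nil => simp [cutWord]
  | cons a y ih =>
    have ih := ih (x := x ++ [a]) fun b c d h => hy b c d (h.cons a)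
    have hs : (siteWord x (a :: y)).count true ≠ 0 ↔ IsCut x (a :: y) := by
      unfold siteWord
      by_cases hc : IsCut x (a :: y)
      · simp [hc, isActive_of_isCut hy hc]
      · split_ifs <;> simp [hc]
    rw [cutWord, append_nil, count_append, Ne, Nat.add_eq_zero_iff, not_and_or, ← Ne, hs, ← Ne, ih]
    constructor
    · rintro (h | ⟨z₁, z₂, rfl, h, hc⟩)
      · exact ⟨[], _, rfl, by simp, by simpa using h⟩
      · exact ⟨a :: z₁, z₂, rfl, h, by simpa using hc⟩
    · rintro ⟨z₁, z₂, h, h₂, hc⟩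
      rcases z₁ with _ | ⟨b, z₁⟩
      · left
        simp only [nil_append] at h
        simpa [h] using hc
      · simp only [cons_append, cons.injEq] at h
        obtain ⟨rfl, rfl⟩ := h
        exact Or.inr ⟨z₁, z₂, rfl, h₂, by simpa using hc⟩

lemma survivors_cons (b : Bool) (v : List Bool) :
    survivors (b :: v) = survivors v + if b = true ∨ v.count true = 0 then 1 else 0 := by
  cases b <;> by_cases h : v.count true = 0 <;> simp [survivors, trailing, h] <;> omega

lemma cutWord_insert_left {x y z : List ℕ} {M : ℕ} (hM : ∀ a ∈ x ++ y ++ z, a < M)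
    (hnd : (x ++ y ++ z).Nodup) (hy : y ≠ []) (h : IsActive x (y ++ z)) :
    cutWord (x ++ M :: y) z [] = replicate (survivors (cutWord (x ++ y) z [])) false := by
  induction z generalizing y with
  | nil => simp [cutWord, survivors, trailing]
  | cons a z ih =>
    have ih := ih (y := y ++ [a]) (by simpa using hM) (by simpa using hnd) (by simp)
      (by simpa using h)
    have hnc : ¬ IsCut (x ++ M :: y) (a :: z) := fun hc => by
      have := hc M (by simp) a (by simp)
      have := hM a (by simp)
      omega
    have e := isActive_insert_left_iff (x := x) (y := y) (z := a :: z) (M := M)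
      (fun b hb => hM b (by simp [hb])) (fun b hb => hM b (by simp [hb]))
      (fun b hb => hM b (mem_append_right _ hb))
    have hz : ∀ b c d, [b, c, d] <+ a :: z → ¬ (d < b ∧ b < c) := fun b c d hs =>
      h.1 b c d (hs.trans (sublist_append_right _ _))
    have hcnt := count_cutWord_pos (x := x ++ (y ++ [a])) (y := z) fun b c d hs =>
      hz b c d (hs.cons a)
    simp only [cutWord, append_assoc, cons_append, append_nil, ih]
    unfold siteWord
    by_cases hact : IsActive (x ++ y) (a :: z)
    · have hB := blocks_iff h hact hnd hy
      have hex : (∃ z₁ z₂, a :: z = z₁ ++ z₂ ∧ z₁ ≠ [] ∧ z₂ ≠ [] ∧ IsCut (x ++ y ++ z₁) z₂) ↔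
          (cutWord (x ++ (y ++ [a])) z []).count true ≠ 0 := by
        rw [hcnt]
        constructor
        · rintro ⟨z₁, z₂, he, h₁, h₂, hc⟩
          rcases z₁ with _ | ⟨b, z₁⟩
          · simp at h₁
          · simp only [cons_append, cons.injEq] at he
            obtain ⟨rfl, rfl⟩ := he
            exact ⟨z₁, z₂, rfl, h₂, by simpa using hc⟩
        · rintro ⟨z₁, z₂, rfl, h₂, hc⟩
          exact ⟨a :: z₁, z₂, rfl, by simp, h₂, by simpa using hc⟩
      rw [hex] at hB
      have e' : IsActive (x ++ M :: y) (a :: z) ↔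
          IsCut (x ++ y) (a :: z) ∨ (cutWord (x ++ (y ++ [a])) z []).count true = 0 := by
        rw [e, hB]
        tauto
      simp only [hact, if_true, singleton_append, survivors_cons, decide_eq_true_eq]
      by_cases hm : IsActive (x ++ M :: y) (a :: z)
      · simp [hm, hnc, e'.1 hm, replicate_succ]
      · simp [hm, mt e'.2 hm]
    · simp [e, hact]

open Classical in
/-- The word of a list with a maximum inserted at an active site. -/
lemma cutWord_insert {x y : List ℕ} {M : ℕ} (hM : ∀ a ∈ x ++ y, a < M) (hnd : (x ++ y).Nodup) :
    cutWord [] (x ++ M :: y) [] =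
      (if IsCut x y then cutWord [] x y else []) ++ siteWord x y ++ cutWord (x ++ [M]) y [] := by
  have hx : ∀ a ∈ x, a < M := fun a ha => hM a (by simp [ha])
  have hy : ∀ a ∈ y, a < M := fun a ha => hM a (by simp [ha])
  have hne : ∀ a ∈ x, ∀ b ∈ y, a ≠ b := fun a ha b hb => (nodup_append.1 hnd).2.2 a ha b hb
  rw [cutWord_append, append_nil, nil_append, cutWord, append_nil,
    cutWord_insert_right (u := []) (by simpa using hx) hy (by simpa using hne),
    siteWord_insert_right hx hy hne, append_assoc]
  simp

lemma cutWord_insert_last {x : List ℕ} {M : ℕ} (hM : ∀ a ∈ x, a < M) (hnd : x.Nodup) :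
    cutWord [] (x ++ [M]) [] = cutWord [] x [] ++ [true] := by
  classical
  rw [cutWord_insert (by simpa using hM) (by simpa using hnd)]
  have hc : IsCut x [] := by simp [IsCut]
  have ha : IsActive x [] := isActive_of_isCut (by simp) hc
  simp [hc, ha, siteWord, cutWord]

open Classical in
lemma cutWord_insert_cons {x y : List ℕ} {a M : ℕ} (hM : ∀ b ∈ x ++ a :: y, b < M)
    (hnd : (x ++ a :: y).Nodup) (h : IsActive x (a :: y)) :
    cutWord [] (x ++ M :: a :: y) [] =
      if IsCut x (a :: y) then
        cutWord [] x (a :: y) ++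
          true :: replicate (survivors (cutWord (x ++ [a]) y []) + 1) false
      else replicate (survivors (cutWord (x ++ [a]) y []) + 2) false := by
  have e := isActive_insert_left_iff (x := x) (y := []) (z := a :: y) (M := M)
      (fun b hb => hM b (by simp [hb])) (by simp) (fun b hb => hM b (mem_append_right _ hb))
  have hnc : ¬ IsCut (x ++ [M]) (a :: y) := fun hc => by
    have := hc M (by simp) a (by simp)
    have := hM a (by simp)
    omega
  have h₁ : IsActive (x ++ [M]) (a :: y) := by
    rw [e]
    simpa [Blocks] using h
  have h₂ := cutWord_insert_left (x := x) (y := [a]) (z := y) (M := M) (by simpa using hM)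
    (by simpa using hnd) (by simp) (by simpa using h)
  rw [cutWord_insert hM hnd]
  simp only [cutWord, append_nil, append_assoc, cons_append, nil_append]
  rw [h₂]
  by_cases hc : IsCut x (a :: y) <;> simp [siteWord, h, h₁, hnc, hc, replicate_succ]

open Classical in
lemma sum_wordSeries_insert {x y : List ℕ} {M : ℕ} (hM : ∀ b ∈ x ++ y, b < M)
    (hnd : (x ++ y).Nodup) (hg : GoodList (x ++ y)) :
    ((permutations'Aux M y).map fun l =>
      if GoodList (x ++ l) then wordSeries (cutWord [] (x ++ l) []) else 0).sum =
      childSeries (cutWord [] x y) (cutWord x y []) := by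
  have hgood := fun z₁ z₂ => goodList_insert_iff (x := z₁) (y := z₂) (M := M)
  induction y generalizing x with
  | nil =>
    have hc : IsActive x [] := isActive_of_isCut (by simp) (by simp [IsCut])
    have hg' : GoodList (x ++ [M]) := (hgood _ _ (by simpa using hM) (by simp)).2 ⟨hg, hc⟩
    simp [permutations'Aux, hg', cutWord_insert_last (M := M) (x := x) (by simpa using hM)
      (by simpa using hnd), childSeries, cutWord]
  | cons a y ih =>
    have ih := ih (x := x ++ [a]) (by simpa using hM) (by simpa using hnd) (by simpa using hg)
    have hg' : GoodList (x ++ M :: a :: y) ↔ IsActive x (a :: y) := by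
      rw [hgood _ _ (fun b hb => hM b (by simp [hb])) (fun b hb => hM b (mem_append_right _ hb))]
      simp [hg]
    rw [cutWord_append, nil_append] at ih
    simp only [cutWord, append_assoc, cons_append, nil_append, append_nil] at ih
    simp only [permutations'Aux, map_cons, sum_cons, map_map, Function.comp_def, hg', ih]
    simp only [cutWord, append_nil]
    by_cases h : IsActive x (a :: y)
    · rw [if_pos h, cutWord_insert_cons hM hnd h]
      by_cases hc : IsCut x (a :: y) <;> simp [siteWord, h, hc, childSeries]
    · simp [siteWord, h]

open Classical in
lemma wordSeries_cutWord {l : List ℕ} {M : ℕ} (hM : ∀ b ∈ l, b < M) (hnd : l.Nodup)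
    (hg : GoodList l) :
    wordSeries (cutWord [] l []) = 1 + PowerSeries.X * ((permutations'Aux M l).map fun l' =>
      if GoodList l' then wordSeries (cutWord [] l' []) else 0).sum := by
  rw [wordSeries_eq]
  have := sum_wordSeries_insert (x := []) (y := l) (by simpa using hM) (by simpa using hnd)
    (by simpa using hg)
  simp only [nil_append] at this
  rw [this]
  simp [cutWord]

open Classical in
/-- The coefficients of `wordSeries`, summed over the permutations of length `n` in the class. -/
noncomputable def coeffSum (n m : ℕ) : ℚ :=
  ((permutations' (range n).reverse).map fun l =>
    if GoodList l then PowerSeries.coeff m (wordSeries (cutWord [] l [])) else 0).sum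

lemma goodList_of_insert {l l' : List ℕ} {M : ℕ} (h : l' ∈ permutations'Aux M l)
    (hg : GoodList l') : GoodList l := by
  have hs : l <+ l' := by
    clear hg
    induction l generalizing l' with
    | nil => simp
    | cons a l ih =>
      simp only [permutations'Aux, mem_cons, mem_map] at h
      rcases h with rfl | ⟨l'', h, rfl⟩
      · exact sublist_cons_self _ _
      · exact (ih h).cons_cons a
  exact ⟨fun a b c d h => hg.1 _ _ _ _ (h.trans hs),
    fun a b c d e h => hg.2.1 _ _ _ _ _ (h.trans hs),
    fun a b c d e h => hg.2.2.1 _ _ _ _ _ (h.trans hs),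
    fun a b c d e f h => hg.2.2.2 _ _ _ _ _ _ (h.trans hs)⟩

lemma coeffSum_succ (n m : ℕ) : coeffSum n (m + 1) = coeffSum (n + 1) m := by
  classical
  have hr : (range (n + 1)).reverse = n :: (range n).reverse := by simp [range_succ]
  unfold coeffSum
  rw [hr, permutations', map_flatMap, flatMap, sum_flatten, map_map, Function.comp_def]
  congr 1
  refine map_congr_left fun l hl => ?_
  have hp : l ~ range n := (mem_permutations'.1 hl).trans (reverse_perm _)
  by_cases hg : GoodList l
  · rw [if_pos hg, wordSeries_cutWord (M := n) (fun b hb => by simpa using hp.subset hb)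
      (hp.nodup_iff.2 nodup_range) hg, map_add, PowerSeries.coeff_succ_X_mul, map_list_sum, map_map]
    simp [PowerSeries.coeff_one, Function.comp_def, apply_ite]
  · rw [if_neg hg, sum_eq_zero]
    intro q hq
    obtain ⟨l', hl', rfl⟩ := mem_map.1 hq
    exact if_neg fun h => hg (goodList_of_insert hl' h)

lemma coeffSum_zero_left (m : ℕ) : coeffSum 0 m = PowerSeries.coeff m (runSeries 0) := by
  have : GoodList [] := by simp [GoodList]
  simp [coeffSum, this, cutWord, wordSeries, permutations']

lemma coeffSum_add (n m : ℕ) : coeffSum n m = coeffSum (n + m) 0 := by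
  induction m generalizing n with
  | zero => rfl
  | succ m ih => rw [coeffSum_succ, ih]; congr 1; omega

open Classical in
lemma coeffSum_zero_right (n : ℕ) :
    coeffSum n 0 =
      ((permutations' (range n).reverse).toFinset.filter fun l => GoodList l).card := by
  have hnd : (permutations' (range n).reverse).Nodup :=
    (permutations_perm_permutations' _).nodup_iff.1
      (nodup_permutations _ (nodup_reverse.2 nodup_range))
  rw [Finset.card_filter, Nat.cast_sum, List.sum_toFinset _ hnd, coeffSum]
  congr 1
  refine map_congr_left fun l _ => ?_
  simp [constantCoeff_wordSeries]

lemma ofFn_sublist_ofFn_iff {k n : ℕ} {s : Fin k → ℕ} {g : Fin n → ℕ} :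
    ofFn s <+ ofFn g ↔ ∃ f : Fin k → Fin n, StrictMono f ∧ ∀ i, s i = g (f i) := by
  rw [sublist_iff_exists_fin_orderEmbedding_get_eq]
  constructor
  · rintro ⟨f, hf⟩
    refine ⟨fun i => (f (i.cast (by simp))).cast (by simp), fun i j hij => ?_, fun i => ?_⟩
    · exact f.strictMono hij
    · have := hf (i.cast (by simp))
      simp only [get_eq_getElem, List.getElem_ofFn] at this
      exact this
  · rintro ⟨f, hm, hf⟩
    refine ⟨OrderEmbedding.ofStrictMono
      (fun i => (f (i.cast (by simp))).cast (by simp)) fun i j hij => hm hij, fun i => ?_⟩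
    have := hf (i.cast (by simp))
    simp only [get_eq_getElem, List.getElem_ofFn]
    exact this

lemma contains_iff {k n : ℕ} {σ : Equiv.Perm (Fin k)} {π : Equiv.Perm (Fin n)} :
    Contains σ π ↔ ∃ s : Fin k → ℕ, ofFn s <+ ofFn (fun i => (π i : ℕ)) ∧
      ∀ i j, σ i < σ j ↔ s i < s j := by
  simp only [ofFn_sublist_ofFn_iff]
  constructor
  · rintro ⟨f, hf, h⟩
    exact ⟨fun i => π (f i), ⟨f, hf, fun _ => rfl⟩, h⟩
  · rintro ⟨s, ⟨f, hf, hs⟩, h⟩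
    exact ⟨f, hf, fun i j => by rw [h, hs, hs]; rfl⟩

lemma inA_iff_goodList {n : ℕ} (π : Equiv.Perm (Fin n)) :
    InA π ↔ GoodList (ofFn fun i => (π i : ℕ)) := by
  unfold InA Avoids GoodList
  simp only [contains_iff, not_exists, not_and]
  refine and_congr ?_ (and_congr ?_ (and_congr ?_ ?_))
  · simp only [Fin.forall_fin_succ_pi, Fin.forall_fin_zero_pi, p4231, Equiv.ofBijective_apply,
      Fin.forall_fin_succ, ofFn_succ, ofFn_zero]
    simp
    refine forall₄_congr fun a b c d => imp_congr_right fun _ => ?_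
    omega
  · simp only [Fin.forall_fin_succ_pi, Fin.forall_fin_zero_pi, p35142, Equiv.ofBijective_apply,
      Fin.forall_fin_succ, ofFn_succ, ofFn_zero]
    simp
    refine forall₅_congr fun a b c d e => imp_congr_right fun _ => ?_
    omega
  · simp only [Fin.forall_fin_succ_pi, Fin.forall_fin_zero_pi, p42513, Equiv.ofBijective_apply,
      Fin.forall_fin_succ, ofFn_succ, ofFn_zero]
    simp
    refine forall₅_congr fun a b c d e => imp_congr_right fun _ => ?_
    omega
  · simp only [Fin.forall_fin_succ_pi, Fin.forall_fin_zero_pi, p351624, Equiv.ofBijective_apply,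
      Fin.forall_fin_succ, ofFn_succ, ofFn_zero]
    simp
    refine forall₅_congr fun a b c d e => forall_congr' fun f => imp_congr_right fun _ => ?_
    omega

lemma natCard_inA (n : ℕ) :
    (Nat.card {π : Equiv.Perm (Fin n) // InA π} : ℚ) = coeffSum n 0 := by
  classical
  rw [coeffSum_zero_right, Nat.cast_inj, ← Fintype.card_coe, ← Nat.card_eq_fintype_card]
  have hmem : ∀ l, l ∈ (permutations' (range n).reverse).toFinset ↔ l ~ range n := fun l => by
    rw [mem_toFinset, mem_permutations']
    exact ⟨fun h => h.trans (reverse_perm _), fun h => h.trans (reverse_perm _).symm⟩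
  have hperm : ∀ π : Equiv.Perm (Fin n), (ofFn fun i => (π i : ℕ)) ~ range n := fun π => by
    refine (perm_ext_iff_of_nodup (nodup_ofFn.2 ?_) nodup_range).2 fun a => ?_
    · exact Fin.val_injective.comp π.injective
    · rw [mem_ofFn, mem_range]
      constructor
      · rintro ⟨i, rfl⟩
        exact (π i).2
      · exact fun h => ⟨π.symm ⟨a, h⟩, by simp⟩
  refine Nat.card_congr (Equiv.ofBijective (fun π => ⟨ofFn fun i => (π.1 i : ℕ), ?_⟩) ⟨?_, ?_⟩)
  · exact Finset.mem_filter.2 ⟨(hmem _).2 (hperm _), (inA_iff_goodList _).1 π.2⟩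
  · intro π τ h
    have h' := ofFn_injective (Subtype.mk.inj h)
    exact Subtype.ext (Equiv.ext fun i => Fin.ext (congrFun h' i))
  · rintro ⟨l, hl⟩
    obtain ⟨hl, hg⟩ := Finset.mem_filter.1 hl
    have hp := (hmem l).1 hl
    obtain rfl : l.length = n := by simpa using hp.length_eq
    let g : Fin l.length → Fin l.length := fun i =>
      ⟨l.get i, by simpa using hp.subset (l.get_mem i)⟩
    have hinj : Function.Injective g := fun i j h =>
      nodup_iff_injective_get.1 (hp.nodup_iff.2 nodup_range) (Fin.mk.inj h)
    have hbij := Finite.injective_iff_bijective.1 hinj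
    have he : (ofFn fun i => (Equiv.ofBijective g hbij i : ℕ)) = l := by
      simp [g]
    exact ⟨⟨Equiv.ofBijective g hbij, (inA_iff_goodList _).2 (he.symm ▸ hg)⟩, Subtype.ext he⟩

end Insertion

theorem statement_19
    (a : ℕ → ℚ) (ha : ∀ n : ℕ, a n = (Nat.card {π : Equiv.Perm (Fin n) // InA π} : ℚ))
    (F : PowerSeries ℚ)
    (hF : F = PowerSeries.mk fun n => if n = 0 then 0 else a n) :
    (1 - 4 * PowerSeries.X) *
        ((1 - PowerSeries.X - 2 * PowerSeries.X ^ 2) -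
          (1 - PowerSeries.X + 2 * PowerSeries.X ^ 2) * F) ^ 2
      = ((1 - 3 * PowerSeries.X - 2 * PowerSeries.X ^ 2) -
          (1 - 3 * PowerSeries.X) * F) ^ 2 := by
  have hF' : F = runSeries 0 - 1 := by
    ext m
    rw [hF, PowerSeries.coeff_mk, map_sub, ← coeffSum_zero_left, coeffSum_add, zero_add, ha,
      natCard_inA, PowerSeries.coeff_one]
    rcases eq_or_ne m 0 with rfl | hm
    · rw [← zero_add 0, ← coeffSum_add, coeffSum_zero_left, ← wordSeries,
        PowerSeries.coeff_zero_eq_constantCoeff_apply, constantCoeff_wordSeries]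
      simp
    · simp [hm]
  rw [hF']
  exact runSeries_zero_eq
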